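/- There exists a function f : ℕ → ℕ such that every tournament T that is strongly 4k-connected and has minimum out-degree at least f(k) is k-linked. -/

import Mathlib

/-- A tournament: a loopless digraph on a finite vertex set in which, for every pair of
distinct vertices `x, y`, exactly one of the edges `(x,y)`, `(y,x)` is present. -/
def IsTournament {V : Type} (G : V → V → Prop) : Prop :=
  (∀ v, ¬ G v v) ∧ ∀ x y : V, x ≠ y → (G x y ↔ ¬ G y x)

/-- A directed path: a nonempty list of pairwise distinct vertices in which consecutive
vertices are joined by a directed edge. -/
def IsDipath {V : Type} (G : V → V → Prop) (p : List V) : Prop :=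
  p ≠ [] ∧ p.Nodup ∧ p.Chain' G

/-- The out-degree of a vertex. -/
noncomputable def outDeg {V : Type} (G : V → V → Prop) (v : V) : ℕ := {u | G v u}.ncard

/-- The in-degree of a vertex. -/
noncomputable def inDeg {V : Type} (G : V → V → Prop) (v : V) : ℕ := {u | G u v}.ncard

/-- A digraph is strongly `k`-connected if it has at least `k+1` vertices and, after removing
any set `S` of at most `k-1` vertices, any vertex can reach any other by a directed path
avoiding `S`. -/
def StronglyKConnected {V : Type} [Fintype V] (G : V → V → Prop) (k : ℕ) : Prop :=
  k + 1 ≤ Fintype.card V ∧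
  ∀ S : Set V, S.ncard ≤ k - 1 → ∀ x y : V, x ∉ S → y ∉ S → x ≠ y →
    ∃ p : List V, IsDipath G p ∧ p.head? = some x ∧ p.getLast? = some y ∧ ∀ v ∈ p, v ∉ S

/-- A digraph is `k`-linked if it has at least `2k` vertices and for any `2k` distinct
vertices `x₁, …, x_k, y₁, …, y_k` there are pairwise vertex-disjoint directed paths
`P₁, …, P_k` with `P i` starting at `x i` and ending at `y i`. -/
def KLinked {V : Type} [Fintype V] (G : V → V → Prop) (k : ℕ) : Prop :=
  2 * k ≤ Fintype.card V ∧
  ∀ x y : Fin k → V, Function.Injective (Sum.elim x y : Fin k ⊕ Fin k → V) →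
    ∃ P : Fin k → List V,
      (∀ i, IsDipath G (P i) ∧ (P i).head? = some (x i) ∧ (P i).getLast? = some (y i)) ∧
      ∀ i j, i ≠ j → ∀ v ∈ P i, v ∉ P j


namespace FourK

/-- A directed walk from `a` to `b`, as a list. -/
def Wk {V : Type} (G : V → V → Prop) (p : List V) (a b : V) : Prop :=
  p.IsChain G ∧ p.head? = some a ∧ p.getLast? = some b

section lists
variable {V : Type} {G : V → V → Prop}

theorem wk_prefix {l1 l2 : List V} {a b c : V} (h : Wk G (l1 ++ c :: l2) a b) :
    Wk G (l1 ++ [c]) a c := by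
  obtain ⟨h1, h2, h3⟩ := h
  refine ⟨(List.isChain_split.1 h1).1, ?_, by simp⟩
  cases l1 <;> simpa using h2

theorem wk_suffix {l1 l2 : List V} {a b c : V} (h : Wk G (l1 ++ c :: l2) a b) :
    Wk G (c :: l2) c b := by
  obtain ⟨h1, h2, h3⟩ := h
  refine ⟨(List.isChain_split.1 h1).2, by simp, ?_⟩
  rw [List.getLast?_append_of_ne_nil _ (by simp)] at h3
  exact h3

theorem wk_glue {l1 l2 : List V} {a b c : V} (h : Wk G (l1 ++ [c]) a c)
    (h' : Wk G (c :: l2) c b) : Wk G (l1 ++ c :: l2) a b := by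
  obtain ⟨h1, h2, h3⟩ := h
  obtain ⟨g1, g2, g3⟩ := h'
  refine ⟨List.isChain_split.2 ⟨h1, g1⟩, ?_, ?_⟩
  · cases l1 <;> simpa using h2
  · rw [List.getLast?_append_of_ne_nil _ (by simp)]
    exact g3

theorem wk_cons {p : List V} {a b c : V} (h : G a b) (hp : Wk G p b c) :
    Wk G (a :: p) a c := by
  obtain ⟨h1, h2, h3⟩ := hp
  cases p with
  | nil => simp at h2
  | cons d t =>
    simp at h2
    subst h2
    exact ⟨List.isChain_cons_cons.2 ⟨h, h1⟩, by simp, by simpa using h3⟩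

theorem wk_single (a : V) : Wk G [a] a a := ⟨by simp, by simp, by simp⟩

theorem wk_head_mem {p : List V} {a b : V} (h : Wk G p a b) : a ∈ p :=
  List.mem_of_mem_head? h.2.1

theorem wk_last_mem {p : List V} {a b : V} (h : Wk G p a b) : b ∈ p :=
  List.mem_of_mem_getLast? h.2.2

theorem wk_form {p : List V} {a b : V} (h : Wk G p a b) : ∃ l, p = l ++ [b] := by
  obtain ⟨_, _, h3⟩ := h
  exact ⟨p.dropLast, (List.dropLast_append_getLast? b h3).symm⟩

theorem wk_form' {p : List V} {a b : V} (h : Wk G p a b) : ∃ l, p = a :: l := by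
  obtain ⟨_, h2, _⟩ := h
  cases p with
  | nil => simp at h2
  | cons d t => simp at h2; subst h2; exact ⟨t, rfl⟩

/-- Joining two walks by an edge. -/
theorem wk_join {p q : List V} {a b c d : V} (h : Wk G p a b) (e : G b c) (h' : Wk G q c d) :
    Wk G (p ++ q) a d := by
  obtain ⟨l, rfl⟩ := wk_form h
  rw [List.append_assoc]
  exact wk_glue h (wk_cons e h')

theorem wk_nodup : ∀ (p : List V) (a b : V), Wk G p a b →
    ∃ q, Wk G q a b ∧ q.Nodup ∧ ∀ v ∈ q, v ∈ p := by
  intro p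
  induction p with
  | nil => intro a b h; simp [Wk] at h
  | cons d t ih =>
    intro a b h
    have hd : d = a := by simpa using h.2.1
    subst hd
    cases t with
    | nil => exact ⟨[d], h, by simp, by simp⟩
    | cons c t' =>
      have hs : Wk G ([d] ++ c :: t') d b := h
      obtain ⟨q, hq, hn, hm⟩ := ih c b (wk_suffix hs)
      have hdc : G d c := (List.isChain_cons_cons.1 h.1).1
      by_cases hdq : d ∈ q
      · obtain ⟨l1, l2, rfl⟩ := List.append_of_mem hdq
        refine ⟨d :: l2, wk_suffix hq, (List.nodup_append.1 hn).2.1, ?_⟩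
        intro v hv
        exact List.mem_cons_of_mem _ (hm v (by simp at hv ⊢; tauto))
      · refine ⟨d :: q, wk_cons hdc hq, List.nodup_cons.2 ⟨hdq, hn⟩, ?_⟩
        intro v hv
        rcases List.mem_cons.1 hv with rfl | hv
        · simp
        · exact List.mem_cons_of_mem _ (hm v hv)

theorem first_hit (S : Finset V) : ∀ p : List V, (∃ v ∈ p, v ∈ S) →
    ∃ l1 c l2, p = l1 ++ c :: l2 ∧ c ∈ S ∧ ∀ v ∈ l1, v ∉ S := by
  intro p
  induction p with
  | nil => rintro ⟨v, hv, _⟩; simp at hv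
  | cons d t ih =>
    rintro ⟨v, hv, hS⟩
    by_cases hd : d ∈ S
    · exact ⟨[], d, t, rfl, hd, by simp⟩
    · rcases List.mem_cons.1 hv with rfl | hv
      · exact absurd hS hd
      · obtain ⟨l1, c, l2, rfl, hc, h⟩ := ih ⟨v, hv, hS⟩
        refine ⟨d :: l1, c, l2, rfl, hc, ?_⟩
        intro w hw
        rcases List.mem_cons.1 hw with rfl | hw
        · exact hd
        · exact h w hw

theorem last_hit (S : Finset V) (p : List V) (h : ∃ v ∈ p, v ∈ S) :
    ∃ l1 c l2, p = l1 ++ c :: l2 ∧ c ∈ S ∧ ∀ v ∈ l2, v ∉ S := by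
  obtain ⟨l1, c, l2, hp, hc, hl⟩ := first_hit S p.reverse (by simpa using h)
  refine ⟨l2.reverse, c, l1.reverse, ?_, hc, by simpa using hl⟩
  rw [← List.reverse_reverse p, hp]
  simp

/-- Remove the edge `(x,y)`. -/
def Del (G : V → V → Prop) (x y : V) : V → V → Prop := fun u v => G u v ∧ ¬ (u = x ∧ v = y)

theorem del_of_left {x y : V} : ∀ (l : List V) (c : V), (∀ v ∈ l, v ≠ x) →
    (l ++ [c]).IsChain G → (l ++ [c]).IsChain (Del G x y) := by
  intro l
  induction l with
  | nil => intro c _ _; simp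
  | cons d t ih =>
    intro c hx h
    have hd : d ≠ x := hx d (by simp)
    have ht := ih c (fun v hv => hx v (by simp [hv]))
    cases t with
    | nil =>
      simp at h ⊢
      exact ⟨h, fun hh => hd hh.1⟩
    | cons e t' =>
      simp only [List.cons_append, List.isChain_cons_cons] at h ht ⊢
      exact ⟨⟨h.1, fun hh => hd hh.1⟩, ht h.2⟩

theorem del_of_right {x y : V} : ∀ (l : List V) (c : V), (∀ v ∈ l, v ≠ y) →
    (c :: l).IsChain G → (c :: l).IsChain (Del G x y) := by
  intro l
  induction l with
  | nil => intro c _ _; simp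
  | cons d t ih =>
    intro c hx h
    have hd : d ≠ y := hx d (by simp)
    simp only [List.isChain_cons_cons] at h ⊢
    exact ⟨⟨h.1, fun hh => hd hh.2⟩, ih d (fun v hv => hx v (by simp [hv])) h.2⟩

theorem chain_restrict {E : Finset V} : ∀ (p : List V), p.IsChain G → (∀ v ∈ p, v ∉ E) →
    p.IsChain (fun u v => G u v ∧ u ∉ E ∧ v ∉ E) := by
  intro p
  induction p with
  | nil => intro _ _; simp
  | cons d t ih =>
    intro h hE
    cases t with
    | nil => simp
    | cons e t' =>
      simp only [List.isChain_cons_cons] at h ⊢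
      exact ⟨⟨h.1, hE d (by simp), hE e (by simp)⟩, ih h.2 (fun v hv => hE v (by simp [hv]))⟩

theorem chain_avoid {E : Finset V} : ∀ (p : List V) (a : V), a ∉ E →
    (a :: p).IsChain (fun u v => G u v ∧ u ∉ E ∧ v ∉ E) → ∀ v ∈ a :: p, v ∉ E := by
  intro p
  induction p with
  | nil => intro a ha _; simpa using ha
  | cons d t ih =>
    intro a ha h v hv
    simp only [List.isChain_cons_cons] at h
    rcases List.mem_cons.1 hv with rfl | hv
    · exact ha
    · exact ih d h.1.2.2 h.2 v hv

end lists

theorem menger {V : Type} [Fintype V] [DecidableEq V] (k : ℕ) : ∀ (n : ℕ) (G : V → V → Prop),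
    {e : V × V | G e.1 e.2}.ncard = n → ∀ A B : Finset V,
    (∀ S : Finset V, (∀ a ∈ A, ∀ b ∈ B, ∀ p, Wk G p a b → ∃ v ∈ p, v ∈ S) → k ≤ S.card) →
    ∃ P : Fin k → List V, (∀ i, ∃ a ∈ A, ∃ b ∈ B, Wk G (P i) a b) ∧
      ∀ i j, i ≠ j → ∀ v ∈ P i, v ∉ P j := by
  intro n
  induction n using Nat.strong_induction_on with
  | _ n IH =>
  intro G hn A B hsep
  by_cases hE : ∃ x y, G x y
  swap
  · have hk : k ≤ (A ∩ B).card := by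
      apply hsep
      intro a ha b hb p hp
      obtain ⟨l, rfl⟩ := wk_form' hp
      cases l with
      | nil =>
        have : a = b := by simpa using hp.2.2
        subst this
        exact ⟨a, by simp, by simp [ha, hb]⟩
      | cons c t => exact absurd ⟨a, c, (List.isChain_cons_cons.1 hp.1).1⟩ hE
    obtain ⟨C, hC, hCk⟩ := Finset.exists_subset_card_eq hk
    let e := C.equivFinOfCardEq hCk
    refine ⟨fun i => [(e.symm i : V)], ?_, ?_⟩
    · intro i
      have := hC (e.symm i).2
      rw [Finset.mem_inter] at this
      exact ⟨_, this.1, _, this.2, wk_single _⟩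
    · intro i j hij v hv hv'
      simp at hv hv'
      apply hij
      have : e.symm i = e.symm j := Subtype.ext (hv.symm.trans hv')
      exact e.symm.injective this
  obtain ⟨x, y, hxy⟩ := hE
  have hlt : {e : V × V | Del G x y e.1 e.2}.ncard < n := by
    rw [← hn]
    apply Set.ncard_lt_ncard _ (Set.toFinite _)
    refine ⟨fun e he => he.1, fun h => ?_⟩
    have := h (show (x, y) ∈ {e : V × V | G e.1 e.2} from hxy)
    exact this.2 ⟨rfl, rfl⟩
  have hmono : ∀ p a b, Wk (Del G x y) p a b → Wk G p a b := fun p a b h =>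
    ⟨h.1.imp (fun _ _ h => h.1), h.2⟩
  by_cases hS : ∀ S : Finset V,
      (∀ a ∈ A, ∀ b ∈ B, ∀ p, Wk (Del G x y) p a b → ∃ v ∈ p, v ∈ S) → k ≤ S.card
  · obtain ⟨P, h1, h2⟩ := IH _ hlt (Del G x y) rfl A B hS
    refine ⟨P, fun i => ?_, h2⟩
    obtain ⟨a, ha, b, hb, h⟩ := h1 i
    exact ⟨a, ha, b, hb, hmono _ _ _ h⟩
  push Not at hS
  obtain ⟨S, hSsep, hSk⟩ := hS
  have sepx : ∀ a ∈ A, ∀ b ∈ B, ∀ p, Wk G p a b → ∃ v ∈ p, v ∈ insert x S := by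
    intro a ha b hb p hp
    by_contra hcon
    push Not at hcon
    obtain ⟨l, rfl⟩ := wk_form hp
    obtain ⟨v, hv, hvS⟩ := hSsep a ha b hb _ ⟨del_of_left l b (fun v hv h =>
      hcon v (by simp [hv]) (by simp [h])) hp.1, hp.2⟩
    exact hcon v hv (by simp [hvS])
  have sepy : ∀ a ∈ A, ∀ b ∈ B, ∀ p, Wk G p a b → ∃ v ∈ p, v ∈ insert y S := by
    intro a ha b hb p hp
    by_contra hcon
    push Not at hcon
    obtain ⟨l, rfl⟩ := wk_form' hp
    obtain ⟨v, hv, hvS⟩ := hSsep a ha b hb _ ⟨del_of_right l a (fun v hv h =>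
      hcon v (by simp [hv]) (by simp [h])) hp.1, hp.2⟩
    exact hcon v hv (by simp [hvS])
  have kx := hsep _ sepx
  have ky := hsep _ sepy
  have hxS : x ∉ S := fun h => by rw [Finset.insert_eq_of_mem h] at kx; omega
  have hyS : y ∉ S := fun h => by rw [Finset.insert_eq_of_mem h] at ky; omega
  have cx : (insert x S).card = k := by rw [Finset.card_insert_of_notMem hxS] at kx ⊢; omega
  have cy : (insert y S).card = k := by rw [Finset.card_insert_of_notMem hyS] at ky ⊢; omega
  obtain ⟨P0, hP0, dP0⟩ := IH _ hlt (Del G x y) rfl A (insert x S) (by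
    intro R hR
    apply hsep
    intro a ha b hb p hp
    obtain ⟨l1, c, l2, rfl, hc, hl⟩ := first_hit _ _ (sepx a ha b hb p hp)
    have h1 := wk_prefix hp
    obtain ⟨v, hv, hvR⟩ := hR a ha c hc _ ⟨del_of_left l1 c (fun v hv h =>
      hl v hv (by simp [h])) h1.1, h1.2⟩
    exact ⟨v, by simp at hv ⊢; tauto, hvR⟩)
  obtain ⟨Q0, hQ0, dQ0⟩ := IH _ hlt (Del G x y) rfl (insert y S) B (by
    intro R hR
    apply hsep
    intro a ha b hb p hp
    obtain ⟨l1, c, l2, rfl, hc, hl⟩ := last_hit _ _ (sepy a ha b hb p hp)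
    have h1 := wk_suffix hp
    obtain ⟨v, hv, hvR⟩ := hR c hc b hb _ ⟨del_of_right l2 c (fun v hv h =>
      hl v hv (by simp [h])) h1.1, h1.2⟩
    exact ⟨v, by simp at hv ⊢; tauto, hvR⟩)
  choose sP hsP eP heP hPw using hP0
  choose sQ hsQ eQ heQ hQw using hQ0
  choose P hP nP mP using fun i => wk_nodup _ _ _ (hPw i)
  choose Q hQ nQ mQ using fun i => wk_nodup _ _ _ (hQw i)
  have dP : ∀ i j v, v ∈ P i → v ∈ P j → i = j := by
    intro i j v h1 h2
    by_contra hij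
    exact dP0 i j hij v (mP i v h1) (mP j v h2)
  have dQ : ∀ i j v, v ∈ Q i → v ∈ Q j → i = j := by
    intro i j v h1 h2
    by_contra hij
    exact dQ0 i j hij v (mQ i v h1) (mQ j v h2)
  have surj : ∀ (C : Finset V) (g : Fin k → V), C.card = k → (∀ i, g i ∈ C) →
      Function.Injective g → ∀ c ∈ C, ∃ i, g i = c := by
    intro C g hC hg hi c hc
    have h1 : Finset.univ.image g = C := by
      apply Finset.eq_of_subset_of_card_le
      · intro v hv
        obtain ⟨i, _, rfl⟩ := Finset.mem_image.1 hv
        exact hg i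
      · rw [Finset.card_image_of_injective _ hi, hC]; simp
    rw [← h1] at hc
    obtain ⟨i, _, h⟩ := Finset.mem_image.1 hc
    exact ⟨i, h⟩
  have injP : Function.Injective eP := fun i j h =>
    dP i j (eP i) (wk_last_mem (hP i)) (h ▸ wk_last_mem (hP j))
  have injQ : Function.Injective sQ := fun i j h =>
    dQ i j (sQ i) (wk_head_mem (hQ i)) (h ▸ wk_head_mem (hQ j))
  have surP := surj _ eP cx heP injP
  have surQ := surj _ sQ cy hsQ injQ
  have endP : ∀ i z, z ∈ P i → z ∈ S → eP i = z := by
    intro i z hz hzS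
    obtain ⟨i0, h0⟩ := surP z (by simp [hzS])
    have : i = i0 := dP i i0 z hz (h0 ▸ wk_last_mem (hP i0))
    rw [this, h0]
  have startQ : ∀ i z, z ∈ Q i → z ∈ S → sQ i = z := by
    intro i z hz hzS
    obtain ⟨i0, h0⟩ := surQ z (by simp [hzS])
    have : i = i0 := dQ i i0 z hz (h0 ▸ wk_head_mem (hQ i0))
    rw [this, h0]
  have cross : ∀ i j z, z ∈ P i → z ∈ Q j → z ∈ S := by
    intro i j z hz hz'
    by_contra hzS
    have hPi := hP i
    have hQj := hQ j
    obtain ⟨l1, l2, hl⟩ := List.append_of_mem hz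
    obtain ⟨m1, m2, hm⟩ := List.append_of_mem hz'
    have nPi := nP i
    have nQj := nQ j
    have eP1 := endP i
    have sQ1 := startQ j
    rw [hl] at hPi nPi eP1
    rw [hm] at hQj nQj sQ1
    obtain ⟨v, hv, hvS⟩ := hSsep _ (hsP i) _ (heQ j) _ (wk_glue (wk_prefix hPi) (wk_suffix hQj))
    have hvz : v ≠ z := fun h => hzS (h ▸ hvS)
    rcases List.mem_append.1 hv with hv | hv
    · have h1 := eP1 v (by simp [hv]) hvS
      have h2 := wk_last_mem (wk_suffix hPi)
      rw [h1] at h2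
      exact (List.nodup_append.1 nPi).2.2 v hv v h2 rfl
    · have hv : v ∈ m2 := by simpa [hvz] using hv
      have h1 := sQ1 v (by simp [hv]) hvS
      have h2 := wk_head_mem (wk_prefix hQj)
      rw [h1] at h2
      have h2 : v ∈ m1 := by simpa [hvz] using h2
      exact (List.nodup_append.1 nQj).2.2 v h2 v (by simp [hv]) rfl
  have hR : ∀ i, ∃ j R, sQ j = (if eP i = x then y else eP i) ∧ Wk G R (sP i) (eQ j) ∧
      ∀ v ∈ R, v ∈ P i ∨ v ∈ Q j := by
    intro i
    by_cases h : eP i = x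
    · obtain ⟨j, hj⟩ := surQ y (by simp)
      refine ⟨j, P i ++ Q j, by simp [h, hj], ?_, by simp⟩
      exact wk_join (hmono _ _ _ (hP i)) (by rw [h, hj]; exact hxy) (hmono _ _ _ (hQ j))
    · have hS' : eP i ∈ S := by simpa [h] using heP i
      obtain ⟨j, hj⟩ := surQ (eP i) (by simp [hS'])
      obtain ⟨l, hl⟩ := wk_form (hP i)
      obtain ⟨m, hm⟩ := wk_form' (hQ j)
      have h1 := hmono _ _ _ (hP i)
      have h2 := hmono _ _ _ (hQ j)
      rw [hl] at h1
      rw [hm, hj] at h2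
      refine ⟨j, l ++ eP i :: m, by simp [h, hj], wk_glue h1 h2, ?_⟩
      intro v hv
      rw [hl, hm, hj]
      simp at hv ⊢
      tauto
  choose J R hJ hRw hRm using hR
  refine ⟨R, fun i => ⟨_, hsP i, _, heQ _, hRw i⟩, ?_⟩
  have injJ : ∀ i j, (if eP i = x then y else eP i) = (if eP j = x then y else eP j) → i = j := by
    intro i j h
    apply injP
    have h1 := heP i
    have h2 := heP j
    rw [Finset.mem_insert] at h1 h2
    split_ifs at h with h3 h4 h4
    · rw [h3, h4]
    · exact absurd (h ▸ (h2.resolve_left h4)) hyS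
    · exact absurd (h ▸ (h1.resolve_left h3)) hyS
    · exact h
  have key : ∀ i j v, v ∈ P i → v ∈ Q (J j) → i = j := by
    intro i j v h1 h2
    have hv := cross _ _ _ h1 h2
    have e1 := endP _ _ h1 hv
    have e2 := startQ _ _ h2 hv
    apply injJ
    have hx : eP i ≠ x := fun h => hxS (by rw [← h, e1]; exact hv)
    rw [← hJ j, e2, if_neg hx, e1]
  intro i j hij v hv hv'
  apply hij
  rcases hRm i v hv with h1 | h1 <;> rcases hRm j v hv' with h2 | h2
  · exact dP _ _ _ h1 h2
  · exact key _ _ _ h1 h2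
  · exact (key _ _ _ h2 h1).symm
  · have := dQ _ _ _ h1 h2
    apply injJ
    rw [← hJ i, ← hJ j, this]

section tournament
variable {V : Type} [Fintype V] [DecidableEq V] {G : V → V → Prop}

theorem asymm (hT : IsTournament G) {x y : V} (h : G x y) : ¬ G y x := by
  have hne : x ≠ y := fun e => hT.1 x (by rw [← e] at h; exact h)
  exact (hT.2 x y hne).1 h

theorem ne_of_edge (hT : IsTournament G) {x y : V} (h : G x y) : x ≠ y :=
  fun e => hT.1 x (by rw [← e] at h; exact h)

open Classical in
theorem half_out (hT : IsTournament G) (U : Finset V) (hU : U.Nonempty) :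
    ∃ v ∈ U, U.card ≤ 2 * (U.filter (fun w => G v w)).card + 1 := by
  by_contra hcon
  push Not at hcon
  have hsum : ∑ v ∈ U, (U.filter (fun w => G v w)).card
      = ∑ v ∈ U, (U.filter (fun w => G w v)).card :=
    Finset.sum_card_bipartiteAbove_eq_sum_card_bipartiteBelow G
  have hlt : ∑ v ∈ U, (U.filter (fun w => G v w)).card
      < ∑ v ∈ U, (U.filter (fun w => G w v)).card := by
    apply Finset.sum_lt_sum_of_nonempty hU
    intro v hv
    have h1 := hcon v hv
    have h2 : U ⊆ insert v (U.filter (fun w => G v w) ∪ U.filter (fun w => G w v)) := by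
      intro w hw
      by_cases e : w = v
      · simp [e]
      · have := hT.2 w v e
        simp only [Finset.mem_insert, Finset.mem_union, Finset.mem_filter]
        by_cases hwv : G w v
        · tauto
        · have : G v w := by tauto
          tauto
    have h3 := Finset.card_le_card h2
    have h4 := Finset.card_insert_le v (U.filter (fun w => G v w) ∪ U.filter (fun w => G w v))
    have h5 := Finset.card_union_le (U.filter (fun w => G v w)) (U.filter (fun w => G w v))
    omega
  omega

open Classical in
/-- A large tournament contains `r` vertices dominating `M` vertices. -/
theorem dominating (hT : IsTournament G) (M : ℕ) : ∀ (r : ℕ) (U : Finset V),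
    2 ^ r * (M + 1) ≤ U.card → ∃ A W : Finset V, A ⊆ U ∧ W ⊆ U ∧ A.card = r ∧ W.card = M ∧
      ∀ a ∈ A, ∀ w ∈ W, G a w := by
  intro r
  induction r with
  | zero =>
    intro U hU
    obtain ⟨W, hW, hc⟩ := Finset.exists_subset_card_eq (show M ≤ U.card by omega)
    exact ⟨∅, W, by simp, hW, by simp, hc, by simp⟩
  | succ r ih =>
    intro U hU
    have hpos : 0 < 2 ^ r * (M + 1) := by positivity
    have h2 : 2 ^ (r + 1) * (M + 1) = 2 * (2 ^ r * (M + 1)) := by ring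
    rw [h2] at hU
    obtain ⟨v, hv, hvc⟩ := half_out hT U (Finset.card_pos.1 (by omega))
    obtain ⟨A, W, hA, hW, hAc, hWc, hd⟩ := ih (U.filter (fun w => G v w)) (by omega)
    have hvA : v ∉ A := fun h => hT.1 v (Finset.mem_filter.1 (hA h)).2
    refine ⟨insert v A, W, ?_, fun w hw => (Finset.mem_filter.1 (hW hw)).1,
      by rw [Finset.card_insert_of_notMem hvA, hAc], hWc, ?_⟩
    · intro w hw
      rcases Finset.mem_insert.1 hw with rfl | hw
      · exact hv
      · exact (Finset.mem_filter.1 (hA hw)).1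
    · intro a ha w hw
      rcases Finset.mem_insert.1 ha with rfl | ha
      · exact (Finset.mem_filter.1 (hW hw)).2
      · exact hd a ha w hw

open Classical in
/-- The hub: a set `W` of `M` vertices such that from any vertex one can robustly reach in exactly
two steps a vertex dominating all of `W`. -/
theorem hub (hT : IsTournament G) (M f : ℕ) (hM : M ≤ Fintype.card V)
    (hD : ∀ v : V, f + 1 + 2 ^ (f + 1) * (M + 1) ≤ outDeg G v) :
    ∃ W : Finset V, W.card = M ∧ ∀ (x : V) (F : Finset V), F.card ≤ f →
      ∃ u v, u ∉ F ∧ v ∉ F ∧ G x u ∧ G u v ∧ ∀ w ∈ W, G v w := by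
  let Z : Finset V → Finset V := fun W => Finset.univ.filter (fun v => ∀ w ∈ W, G v w)
  obtain ⟨W, hW, hmax⟩ := Finset.exists_max_image (Finset.powersetCard M (Finset.univ : Finset V))
    (fun W => (Z W).card) (Finset.powersetCard_nonempty.2 (by simpa using hM))
  have hWM := (Finset.mem_powersetCard.1 hW).2
  refine ⟨W, hWM, ?_⟩
  intro x F hF
  by_contra hcon
  push Not at hcon
  have hZ : ∀ z, z ∈ Z W ↔ ∀ w ∈ W, G z w := by intro z; simp [Z]
  let U := Finset.univ.filter (fun u => G x u) \ F
  have hUm : ∀ u, u ∈ U ↔ G x u ∧ u ∉ F := by intro u; simp [U]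
  have hdom : ∀ u ∈ U, ∀ z ∈ Z W, z ∉ F → u ≠ z → G z u := by
    intro u hu z hz hzF hne
    rw [hUm] at hu
    by_contra hzu
    have : G u z := (hT.2 u z hne).2 hzu
    obtain ⟨w, hw, hn⟩ := hcon u z hu.2 hzF hu.1 this
    exact hn ((hZ z).1 hz w hw)
  have hone : (U ∩ Z W).card ≤ 1 := by
    rw [Finset.card_le_one]
    intro a ha b hb
    rw [Finset.mem_inter] at ha hb
    by_contra hab
    exact asymm hT (hdom a ha.1 b hb.2 ((hUm b).1 hb.1).2 hab)
      (hdom b hb.1 a ha.2 ((hUm a).1 ha.1).2 (Ne.symm hab))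
  have hout : f + 1 + 2 ^ (f + 1) * (M + 1) ≤ (Finset.univ.filter (fun u => G x u)).card := by
    have h := hD x
    unfold outDeg at h
    rw [Set.ncard_eq_toFinset_card'] at h
    convert h using 2
    ext; simp
  have hUc : (Finset.univ.filter (fun u => G x u)).card ≤ U.card + F.card := by
    have := Finset.le_card_sdiff F (Finset.univ.filter (fun u => G x u))
    simp only [U]
    omega
  have hU'c : U.card ≤ (U \ Z W).card + 1 := by
    have := Finset.card_sdiff_add_card_inter U (Z W)
    omega
  obtain ⟨A, W', hA, hW', hAc, hWc, hd⟩ := dominating hT M (f + 1) (U \ Z W) (by omega)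
  have hsub : (Z W \ F) ∪ A ⊆ Z W' := by
    intro z hz
    simp only [Z, Finset.mem_filter, Finset.mem_univ, true_and]
    intro w hw
    have hwU := Finset.mem_sdiff.1 (hW' hw)
    rcases Finset.mem_union.1 hz with hz | hz
    · rw [Finset.mem_sdiff] at hz
      exact hdom w hwU.1 z hz.1 hz.2 (fun e => hwU.2 (e ▸ hz.1))
    · exact hd z hz w hw
  have hdis : Disjoint (Z W \ F) A := by
    rw [Finset.disjoint_left]
    intro z hz hzA
    exact (Finset.mem_sdiff.1 (hA hzA)).2 (Finset.mem_sdiff.1 hz).1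
  have h1 := Finset.card_le_card hsub
  rw [Finset.card_union_of_disjoint hdis] at h1
  have h2 := Finset.le_card_sdiff F (Z W)
  have h3 := hmax W' (Finset.mem_powersetCard.2 ⟨by simp, hWc⟩)
  omega

/-- Greedy choice of disjoint two-step paths into the dominators of `W`. -/
theorem greedy (hT : IsTournament G) (f : ℕ) (W : Finset V)
    (H : ∀ (x : V) (F : Finset V), F.card ≤ f →
      ∃ u v, u ∉ F ∧ v ∉ F ∧ G x u ∧ G u v ∧ ∀ w ∈ W, G v w) :
    ∀ (k : ℕ) (s : Fin k → V) (F : Finset V), F.card + 2 * k ≤ f →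
    ∃ u v : Fin k → V, (∀ i, u i ∉ F ∧ v i ∉ F ∧ G (s i) (u i) ∧ G (u i) (v i) ∧
      ∀ w ∈ W, G (v i) w) ∧ (∀ i j, u i = u j → i = j) ∧ (∀ i j, v i = v j → i = j) ∧
      ∀ i j, u i ≠ v j := by
  intro k
  induction k with
  | zero =>
    intro s F _
    exact ⟨s, s, fun i => i.elim0, fun i => i.elim0, fun i => i.elim0, fun i => i.elim0⟩
  | succ k ih =>
    intro s F hF
    obtain ⟨u0, v0, h1, h2, h3, h4, h5⟩ := H (s 0) F (by omega)
    have hc : (insert u0 (insert v0 F)).card ≤ F.card + 2 := by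
      have := Finset.card_insert_le u0 (insert v0 F)
      have := Finset.card_insert_le v0 F
      omega
    obtain ⟨u, v, ha, hu, hv, huv⟩ := ih (fun i => s i.succ) (insert u0 (insert v0 F)) (by omega)
    have ha1 : ∀ i, u i ≠ u0 ∧ u i ≠ v0 ∧ u i ∉ F := by
      intro i
      have := (ha i).1
      simpa using this
    have ha2 : ∀ i, v i ≠ u0 ∧ v i ≠ v0 ∧ v i ∉ F := by
      intro i
      have := (ha i).2.1
      simpa using this
    refine ⟨Fin.cons u0 u, Fin.cons v0 v, ?_, ?_, ?_, ?_⟩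
    · intro i
      refine Fin.cases ?_ (fun i => ?_) i
      · exact ⟨h1, h2, h3, h4, h5⟩
      · exact ⟨(ha1 i).2.2, (ha2 i).2.2, (ha i).2.2⟩
    · intro i j
      refine Fin.cases ?_ (fun i => ?_) i <;> refine Fin.cases ?_ (fun j => ?_) j
      · simp
      · intro h; exact absurd h.symm (ha1 j).1
      · intro h; exact absurd h (ha1 i).1
      · intro h; exact congrArg _ (hu i j h)
    · intro i j
      refine Fin.cases ?_ (fun i => ?_) i <;> refine Fin.cases ?_ (fun j => ?_) j
      · simp
      · intro h; exact absurd h.symm (ha2 j).2.1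
      · intro h; exact absurd h (ha2 i).2.1
      · intro h; exact congrArg _ (hv i j h)
    · intro i j
      refine Fin.cases ?_ (fun i => ?_) i <;> refine Fin.cases ?_ (fun j => ?_) j
      · exact ne_of_edge hT h4
      · exact (ha2 j).1.symm
      · exact (ha1 i).2.1
      · exact huv i j

/-- A family of disjoint walks from `B` to the `y i`, avoiding `E`. -/
def Good (G : V → V → Prop) (k : ℕ) (B E : Finset V) (y : Fin k → V) (Q : Fin k → List V) : Prop :=
  (∀ i, ∃ b ∈ B, Wk G (Q i) b (y i)) ∧ (∀ i, ∀ v ∈ Q i, v ∉ E) ∧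
    ∀ i j, i ≠ j → ∀ v ∈ Q i, v ∉ Q j

theorem exists_good (k : ℕ) (hk : 0 < k) (hC : StronglyKConnected G (4 * k)) (B E : Finset V)
    (y : Fin k → V) (hy : Function.Injective y) (hE : E.card ≤ 3 * k) (hB : k ≤ B.card)
    (hBE : Disjoint B E) (hyE : ∀ i, y i ∉ E) (hyB : ∀ i, y i ∉ B) :
    ∃ Q, Good G k B E y Q := by
  have hYc : (Finset.univ.image y).card = k := by
    rw [Finset.card_image_of_injective _ hy]; simp
  obtain ⟨P, hP, dP⟩ := menger k _ (fun u v => G u v ∧ u ∉ E ∧ v ∉ E) rfl B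
    (Finset.univ.image y) (by
      intro S hS
      by_contra hlt
      obtain ⟨b, hb, hbS⟩ := Finset.exists_mem_notMem_of_card_lt_card (show S.card < B.card by omega)
      obtain ⟨z, hz, hzS⟩ := Finset.exists_mem_notMem_of_card_lt_card
        (show S.card < (Finset.univ.image y).card by omega)
      obtain ⟨i, _, rfl⟩ := Finset.mem_image.1 hz
      have hbE : b ∉ E := Finset.disjoint_left.1 hBE hb
      obtain ⟨p, hp, hh, hl, hav⟩ := hC.2 (↑(S ∪ E)) (by
        rw [Set.ncard_coe_finset]
        have := Finset.card_union_le S E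
        omega) b (y i) (by simp [hbS, hbE]) (by simp [hzS, hyE i]) (fun e => hyB i (e ▸ hb))
      have hav' : ∀ v ∈ p, v ∉ S ∧ v ∉ E := by
        intro v hv
        have := hav v hv
        simpa using this
      obtain ⟨v, hv, hvS⟩ := hS b hb (y i) hz p
        ⟨chain_restrict p hp.2.2 (fun v hv => (hav' v hv).2), hh, hl⟩
      exact (hav' v hv).1 hvS)
  choose a ha b hb hw using hP
  have hbi : ∀ i, ∃ j, y j = b i := by
    intro i
    obtain ⟨j, _, h⟩ := Finset.mem_image.1 (hb i)
    exact ⟨j, h⟩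
  choose σ hσ using hbi
  have hσi : Function.Injective σ := by
    intro i j h
    by_contra hij
    have h1 := wk_last_mem (hw i)
    have h2 := wk_last_mem (hw j)
    rw [← hσ] at h1 h2
    rw [h] at h1
    exact dP i j hij _ h1 h2
  have hσb := Finite.injective_iff_bijective.1 hσi
  let τ := Equiv.ofBijective σ hσb
  have hτ : ∀ i, σ (τ.symm i) = i := fun i => τ.apply_symm_apply i
  refine ⟨fun i => P (τ.symm i), fun i => ⟨_, ha (τ.symm i), ?_⟩, ?_, ?_⟩
  · have h := hw (τ.symm i)
    rw [← hσ, hτ] at h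
    exact ⟨h.1.imp (fun _ _ h => h.1), h.2⟩
  · intro i
    have h := hw (τ.symm i)
    obtain ⟨l, hl⟩ := wk_form' h
    show ∀ v ∈ P (τ.symm i), v ∉ E
    rw [hl] at h ⊢
    exact chain_avoid l _ (Finset.disjoint_left.1 hBE (ha _)) h.1
  · intro i j hij
    exact dP _ _ (fun h => hij (τ.symm.injective h))

theorem main (k : ℕ) (hk : 0 < k) (hT : IsTournament G) (hC : StronglyKConnected G (4 * k))
    (hD : ∀ v : V, 13 * k + 1 + 2 ^ (13 * k + 1) * (4 * k + 1) ≤ outDeg G v)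
    (x y : Fin k → V) (hx : Function.Injective x) (hy : Function.Injective y)
    (hxy : ∀ i j, x i ≠ y j) :
    ∃ P : Fin k → List V, (∀ i, Wk G (P i) (x i) (y i)) ∧
      ∀ i j, i ≠ j → ∀ v ∈ P i, v ∉ P j := by
  obtain ⟨W, hWc, H⟩ := hub hT (4 * k) (13 * k) (by have := hC.1; omega) hD
  have cim : ∀ g : Fin k → V, (Finset.univ.image g).card ≤ k := by
    intro g
    have := Finset.card_image_le (s := (Finset.univ : Finset (Fin k))) (f := g)
    simpa using this
  have mim : ∀ (g : Fin k → V) i, g i ∈ Finset.univ.image g := fun g i =>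
    Finset.mem_image_of_mem _ (Finset.mem_univ i)
  set X := Finset.univ.image x with hX
  set Y := Finset.univ.image y with hY
  have cX : X.card ≤ k := cim x
  have cY : Y.card ≤ k := cim y
  -- entry paths
  obtain ⟨u, v, hE1, hu, hv, huv⟩ := greedy hT (13 * k) W H k x (X ∪ Y ∪ W) (by
    have := Finset.card_union_le (X ∪ Y) W
    have := Finset.card_union_le X Y
    omega)
  have hu' : ∀ i, u i ∉ X ∧ u i ∉ Y ∧ u i ∉ W := by
    intro i
    have := (hE1 i).1
    simp only [Finset.mem_union, not_or] at this
    tauto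
  have hv' : ∀ i, v i ∉ X ∧ v i ∉ Y ∧ v i ∉ W := by
    intro i
    have := (hE1 i).2.1
    simp only [Finset.mem_union, not_or] at this
    tauto
  set E := X ∪ Finset.univ.image u ∪ Finset.univ.image v with hEdef
  have cE : E.card ≤ 3 * k := by
    rw [hEdef]
    have := Finset.card_union_le (X ∪ Finset.univ.image u) (Finset.univ.image v)
    have := Finset.card_union_le X (Finset.univ.image u)
    have := cim u
    have := cim v
    omega
  have hmE : ∀ z, z ∈ E ↔ (∃ i, x i = z) ∨ (∃ i, u i = z) ∨ (∃ i, v i = z) := by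
    intro z
    simp [hEdef, hX, or_assoc]
  have hYE : ∀ i, y i ∉ E := by
    intro i h
    rcases (hmE _).1 h with ⟨j, h⟩ | ⟨j, h⟩ | ⟨j, h⟩
    · exact hxy j i h
    · exact (hu' j).2.1 (h ▸ mim y i)
    · exact (hv' j).2.1 (h ▸ mim y i)
  set B := W \ (X ∪ Y) with hBdef
  have cB : 2 * k ≤ B.card := by
    rw [hBdef]
    have := Finset.le_card_sdiff (X ∪ Y) W
    have := Finset.card_union_le X Y
    omega
  have hBW : ∀ b ∈ B, b ∈ W ∧ b ∉ X ∧ b ∉ Y := by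
    intro b hb
    simp only [hBdef, Finset.mem_sdiff, Finset.mem_union, not_or] at hb
    exact hb
  have hBE : Disjoint B E := by
    rw [Finset.disjoint_left]
    intro b hb h
    obtain ⟨h1, h2, h3⟩ := hBW b hb
    rcases (hmE _).1 h with ⟨j, h⟩ | ⟨j, h⟩ | ⟨j, h⟩
    · exact h2 (h ▸ mim x j)
    · exact (hu' j).2.2 (h ▸ h1)
    · exact (hv' j).2.2 (h ▸ h1)
  -- a shortest family of exit paths
  obtain ⟨Q, hQ, hmin⟩ : ∃ Q, Good G k B E y Q ∧ ∀ Q', Good G k B E y Q' →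
      ∑ i, (Q i).length ≤ ∑ i, (Q' i).length := by
    have hne : {Q | Good G k B E y Q}.Nonempty :=
      exists_good k hk hC B E y hy cE (by omega) hBE hYE
        (fun i h => (hBW _ h).2.2 (mim y i))
    refine ⟨Function.argminOn (fun Q : Fin k → List V => ∑ i, (Q i).length) _ hne,
      Function.argminOn_mem _ _ hne, fun Q' hQ' => ?_⟩
    exact Function.argminOn_le (fun Q : Fin k → List V => ∑ i, (Q i).length) _ hQ'
  obtain ⟨hQ1, hQ2, hQ3⟩ := hQ
  choose s hsB hQw using hQ1
  -- replacing one path by another one cannot make it shorter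
  have repl : ∀ i q b, b ∈ B → Wk G q b (y i) → (∀ z ∈ q, z ∉ E) →
      (∀ z ∈ q, z ∈ Q i ∨ ∀ j, z ∉ Q j) → (Q i).length ≤ q.length := by
    intro i q b hb hq hqE hqQ
    have h := hmin (Function.update Q i q) (by
      refine ⟨?_, ?_, ?_⟩
      · intro j
        by_cases hj : j = i
        · subst hj; simpa using ⟨b, hb, hq⟩
        · simpa [hj] using ⟨s j, hsB j, hQw j⟩
      · intro j
        by_cases hj : j = i
        · subst hj; simpa using hqE
        · simpa [hj] using hQ2 j
      · intro j l hjl z hz hz'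
        by_cases hj : j = i
        · subst hj
          have hl : l ≠ j := Ne.symm hjl
          simp [hl] at hz hz'
          rcases hqQ z hz with h | h
          · exact hQ3 j l hjl z h hz'
          · exact h l hz'
        · by_cases hl : l = i
          · subst hl
            simp [hj] at hz hz'
            rcases hqQ z hz' with h | h
            · exact hQ3 j l hjl z hz h
            · exact h j hz
          · simp [hj, hl] at hz hz'
            exact hQ3 j l hjl z hz hz')
    by_contra hlt
    have : ∑ j, (Function.update Q i q j).length < ∑ j, (Q j).length := by
      apply Finset.sum_lt_sum
      · intro j _
        by_cases hj : j = i
        · subst hj; simp; omega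
        · simp [hj]
      · exact ⟨i, Finset.mem_univ _, by simp; omega⟩
    omega
  -- only the starting vertices are in B
  have hstart : ∀ i, ∀ b ∈ B, b ∈ Q i → b = s i := by
    intro i b hb hbQ
    have hw := hQw i
    have hr := repl i
    have hE := hQ2 i
    obtain ⟨l1, l2, hl⟩ := List.append_of_mem hbQ
    rw [hl] at hw hr hE
    have := hr (b :: l2) b hb (wk_suffix hw) (fun z hz => hE z (by simp at hz ⊢; tauto))
      (fun z hz => Or.inl (by simp at hz ⊢; tauto))
    have h0 : l1 = [] := by
      simp only [List.length_append, List.length_cons] at this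
      exact List.eq_nil_of_length_eq_zero (by omega)
    subst h0
    have := hw.2.1
    simpa using this
  -- fresh vertices
  obtain ⟨C, hCsub, hCc⟩ := Finset.exists_subset_card_eq
    (show k ≤ (B \ Finset.univ.image s).card by
      have := Finset.le_card_sdiff (Finset.univ.image s) B
      have := cim s
      omega)
  let e := C.equivFinOfCardEq hCc
  obtain ⟨w, hwB, hwi, hwQ⟩ : ∃ w : Fin k → V, (∀ i, w i ∈ B) ∧ (∀ i j, w i = w j → i = j) ∧
      ∀ i j, w i ∉ Q j := by
    refine ⟨fun i => e.symm i, fun i => ?_, fun i j h => ?_, fun i j h => ?_⟩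
    · exact (Finset.mem_sdiff.1 (hCsub (e.symm i).2)).1
    · exact e.symm.injective (Subtype.ext h)
    · have h1 := Finset.mem_sdiff.1 (hCsub (e.symm i).2)
      have h2 := hstart j _ h1.1 h
      exact h1.2 (h2 ▸ mim s j)
  have hwE : ∀ i, w i ∉ E := fun i => Finset.disjoint_left.1 hBE (hwB i)
  -- connecting paths
  set T3 := Finset.univ.biUnion (fun i => ((Q i).take 3).toFinset) with hT3
  have cT3 : T3.card ≤ k * 3 := by
    have h := Finset.card_biUnion_le_card_mul (Finset.univ : Finset (Fin k))
      (fun i => ((Q i).take 3).toFinset) 3 (by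
        intro i _
        refine (List.toFinset_card_le _).trans ?_
        simp)
    simpa using h
  obtain ⟨p, r, hpr, hp, hr, hpr'⟩ := greedy hT (13 * k) W H k w (E ∪ Y ∪ W ∪ T3) (by
    have := Finset.card_union_le (E ∪ Y ∪ W) T3
    have := Finset.card_union_le (E ∪ Y) W
    have := Finset.card_union_le E Y
    omega)
  have hF : ∀ z, z ∉ E ∪ Y ∪ W ∪ T3 → z ∉ E ∧ z ∉ W ∧
      ∀ i l1 l2, Q i = l1 ++ z :: l2 → 3 ≤ l1.length := by
    intro z hz
    simp only [Finset.mem_union, not_or] at hz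
    refine ⟨by tauto, by tauto, ?_⟩
    intro i l1 l2 hl
    by_contra hlt
    apply hz.2
    rw [hT3, Finset.mem_biUnion]
    refine ⟨i, Finset.mem_univ _, ?_⟩
    rw [List.mem_toFinset, hl, List.take_append]
    have : 3 - l1.length = (2 - l1.length) + 1 := by omega
    rw [this, List.take_succ_cons]
    simp
  have hpF := fun i => hF _ (hpr i).1
  have hrF := fun i => hF _ (hpr i).2.1
  have hpQ : ∀ i j, p i ∉ Q j := by
    intro i j h
    obtain ⟨l1, l2, hl⟩ := List.append_of_mem h
    have h3 := (hpF i).2.2 j l1 l2 hl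
    have hw := hQw j
    rw [hl] at hw
    have := repl j (w i :: p i :: l2) (w i) (hwB i) (wk_cons (hpr i).2.2.1 (wk_suffix hw))
      (by
        intro z hz
        rcases List.mem_cons.1 hz with rfl | hz
        · exact hwE i
        · exact hQ2 j z (by rw [hl]; simp at hz ⊢; tauto))
      (by
        intro z hz
        rcases List.mem_cons.1 hz with rfl | hz
        · exact Or.inr (hwQ i)
        · exact Or.inl (by rw [hl]; simp at hz ⊢; tauto))
    rw [hl] at this
    simp at this
    omega
  have hrQ : ∀ i j, r i ∉ Q j := by
    intro i j h
    obtain ⟨l1, l2, hl⟩ := List.append_of_mem h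
    have h3 := (hrF i).2.2 j l1 l2 hl
    have hw := hQw j
    rw [hl] at hw
    have := repl j (w i :: p i :: r i :: l2) (w i) (hwB i)
      (wk_cons (hpr i).2.2.1 (wk_cons (hpr i).2.2.2.1 (wk_suffix hw)))
      (by
        intro z hz
        rcases List.mem_cons.1 hz with rfl | hz
        · exact hwE i
        rcases List.mem_cons.1 hz with rfl | hz
        · exact (hpF i).1
        · exact hQ2 j z (by rw [hl]; simp at hz ⊢; tauto))
      (by
        intro z hz
        rcases List.mem_cons.1 hz with rfl | hz
        · exact Or.inr (hwQ i)
        rcases List.mem_cons.1 hz with rfl | hz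
        · exact Or.inr (hpQ i)
        · exact Or.inl (by rw [hl]; simp at hz ⊢; tauto))
    rw [hl] at this
    simp at this
    omega
  refine ⟨fun i => x i :: u i :: v i :: w i :: p i :: r i :: Q i, ?_, ?_⟩
  · intro i
    exact wk_cons (hE1 i).2.2.1 (wk_cons (hE1 i).2.2.2.1
      (wk_cons ((hE1 i).2.2.2.2 _ (hBW _ (hwB i)).1) (wk_cons (hpr i).2.2.1
      (wk_cons (hpr i).2.2.2.1 (wk_cons ((hpr i).2.2.2.2 _ (hBW _ (hsB i)).1) (hQw i))))))
  · have xE : ∀ i, x i ∈ E := fun i => (hmE _).2 (Or.inl ⟨i, rfl⟩)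
    have uE : ∀ i, u i ∈ E := fun i => (hmE _).2 (Or.inr (Or.inl ⟨i, rfl⟩))
    have vE : ∀ i, v i ∈ E := fun i => (hmE _).2 (Or.inr (Or.inr ⟨i, rfl⟩))
    have hxu : ∀ i j, x i ≠ u j := fun i j h => (hu' j).1 (h ▸ mim x i)
    have hxv : ∀ i j, x i ≠ v j := fun i j h => (hv' j).1 (h ▸ mim x i)
    have hwp : ∀ i j, w i ≠ p j := fun i j h => (hpF j).2.1 (h ▸ (hBW _ (hwB i)).1)
    have hwr : ∀ i j, w i ≠ r j := fun i j h => (hrF j).2.1 (h ▸ (hBW _ (hwB i)).1)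
    -- first part lies in E, second part outside
    intro i j hij z hz hz'
    have split : ∀ i, z ∈ x i :: u i :: v i :: w i :: p i :: r i :: Q i →
        (z ∈ E ∧ (z = x i ∨ z = u i ∨ z = v i)) ∨
        (z ∉ E ∧ ((∀ j, z ∉ Q j) ∧ (z = w i ∨ z = p i ∨ z = r i) ∨ z ∈ Q i)) := by
      intro i hz
      simp only [List.mem_cons] at hz
      rcases hz with rfl | rfl | rfl | rfl | rfl | rfl | hz
      · exact Or.inl ⟨xE i, by simp⟩
      · exact Or.inl ⟨uE i, by simp⟩
      · exact Or.inl ⟨vE i, by simp⟩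
      · exact Or.inr ⟨hwE i, Or.inl ⟨hwQ i, by simp⟩⟩
      · exact Or.inr ⟨(hpF i).1, Or.inl ⟨hpQ i, by simp⟩⟩
      · exact Or.inr ⟨(hrF i).1, Or.inl ⟨hrQ i, by simp⟩⟩
      · exact Or.inr ⟨hQ2 i z hz, Or.inr hz⟩
    rcases split i hz with ⟨h1, h2⟩ | ⟨h1, h2⟩ <;> rcases split j hz' with ⟨g1, g2⟩ | ⟨g1, g2⟩
    · rcases h2 with h2 | h2 | h2 <;> rcases g2 with g2 | g2 | g2 <;> rw [h2] at g2
      · exact hij (hx g2)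
      · exact hxu _ _ g2
      · exact hxv _ _ g2
      · exact hxu _ _ g2.symm
      · exact hij (hu _ _ g2)
      · exact huv _ _ g2
      · exact hxv _ _ g2.symm
      · exact huv _ _ g2.symm
      · exact hij (hv _ _ g2)
    · exact g1 h1
    · exact h1 g1
    · rcases h2 with ⟨h3, h2⟩ | h2 <;> rcases g2 with ⟨g3, g2⟩ | g2
      · rcases h2 with h2 | h2 | h2 <;> rcases g2 with g2 | g2 | g2 <;> rw [h2] at g2
        · exact hij (hwi _ _ g2)
        · exact hwp _ _ g2
        · exact hwr _ _ g2
        · exact hwp _ _ g2.symm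
        · exact hij (hp _ _ g2)
        · exact hpr' _ _ g2
        · exact hwr _ _ g2.symm
        · exact hpr' _ _ g2.symm
        · exact hij (hr _ _ g2)
      · exact h3 j g2
      · exact g3 i h2
      · exact hQ3 i j hij z h2 g2

end tournament

end FourK

/-- There exists a function `f : ℕ → ℕ` such that every `4k`-strongly-connected tournament
with minimum out-degree at least `f(k)` is `k`-linked. -/
theorem exists_function_fourk_linked :
    ∃ f : ℕ → ℕ, ∀ (k : ℕ) (V : Type) [Fintype V] (G : V → V → Prop),
      IsTournament G → StronglyKConnected G (4 * k) →
      (∀ v : V, f k ≤ outDeg G v) → KLinked G k := by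
  classical
  refine ⟨fun k => 13 * k + 1 + 2 ^ (13 * k + 1) * (4 * k + 1), ?_⟩
  intro k V _ G hT hC hD
  refine ⟨by have := hC.1; omega, ?_⟩
  intro x y hinj
  rcases Nat.eq_zero_or_pos k with rfl | hk
  · exact ⟨fun _ => [], fun i => i.elim0, fun i => i.elim0⟩
  obtain ⟨P, hP, dP⟩ := FourK.main k hk hT hC hD x y
    (fun i j h => Sum.inl_injective (hinj (a₁ := Sum.inl i) (a₂ := Sum.inl j) h))
    (fun i j h => Sum.inr_injective (hinj (a₁ := Sum.inr i) (a₂ := Sum.inr j) h))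
    (fun i j h => by
      have := hinj (a₁ := Sum.inl i) (a₂ := Sum.inr j) h
      simp at this)
  choose R hR nR mR using fun i => FourK.wk_nodup _ _ _ (hP i)
  refine ⟨R, fun i => ⟨⟨?_, nR i, (hR i).1⟩, (hR i).2⟩, ?_⟩
  · exact List.ne_nil_of_mem (FourK.wk_head_mem (hR i))
  · intro i j hij z hz hz'
    exact dP i j hij z (mR i z hz) (mR j z hz')
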